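/- arXiv:1011.0138 — 2 statements merged into one kernel-verified Lean document; each statement's English description precedes it below -/
import Mathlib

section
/- Let μ be a finite Borel measure on ℝ all of whose moments y_k = ∫ x^k dμ are finite, let d ∈ ℕ, and let b ∈ ℝ be such that H_d(−θ_b y) is positive semidefinite. Let σ be a finite sum of squares of real polynomials each of degree at most d, normalized so that ∫ σ dμ = 1. Then b ≥ ∫ x σ(x) dμ(x). -/
open MeasureTheory Filter

/-- The support of a measure: the smallest closed set whose complement is null. -/
noncomputable def msupport {α : Type*} [TopologicalSpace α] [MeasurableSpace α]
    (μ : Measure α) : Set α :=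
  ⋂₀ {C : Set α | IsClosed C ∧ μ Cᶜ = 0}

/-- The localizing matrix `H_d(θ_a y)` associated with the moment sequence `y` and the
polynomial `θ_a(x) = x - a`: its `(i,j)` entry is `y_{i+j+1} - a y_{i+j}`. -/
noncomputable def locMat (y : ℕ → ℝ) (d : ℕ) (a : ℝ) :
    Matrix (Fin (d + 1)) (Fin (d + 1)) ℝ :=
  Matrix.of fun i j : Fin (d + 1) => y (i + j + 1 : ℕ) - a * y (i + j : ℕ)

/-- The localizing matrix `H_d(-θ_b y)` associated with the moment sequence `y` and the
polynomial `-θ_b(x) = b - x`: its `(i,j)` entry is `b y_{i+j} - y_{i+j+1}`. -/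
noncomputable def negLocMat (y : ℕ → ℝ) (d : ℕ) (b : ℝ) :
    Matrix (Fin (d + 1)) (Fin (d + 1)) ℝ :=
  Matrix.of fun i j : Fin (d + 1) => b * y (i + j : ℕ) - y (i + j + 1 : ℕ)

/-- Polynomials are integrable against a measure having all its moments. -/
theorem integrable_polynomial_eval {μ : Measure ℝ}
    (hint : ∀ k : ℕ, Integrable (fun x => x ^ k) μ) (q : Polynomial ℝ) :
    Integrable (fun x => q.eval x) μ := by
  simp only [Polynomial.eval_eq_sum_range]
  exact integrable_finsetSum _ fun k _ => (hint k).const_mul _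

/-- The quadratic form of the localizing matrix `H_d(-θ_b y)` is `p ↦ ∫ (b - x) p(x)² dμ`. -/
theorem dotProduct_negLocMat_mulVec {μ : Measure ℝ}
    (hint : ∀ k : ℕ, Integrable (fun x => x ^ k) μ)
    {y : ℕ → ℝ} (hy : ∀ k, y k = ∫ x, x ^ k ∂μ) (d : ℕ) (b : ℝ)
    (p : Polynomial ℝ) (hdeg : p.natDegree ≤ d) :
    (fun i : Fin (d + 1) => p.coeff i) ⬝ᵥ
        (negLocMat y d b).mulVec (fun i : Fin (d + 1) => p.coeff i) =
      ∫ x, (b - x) * p.eval x ^ 2 ∂μ := by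
  have hterm : ∀ (c : ℝ) (k : ℕ), Integrable (fun x => c * (b * x ^ k - x ^ (k + 1))) μ :=
    fun c k => (((hint k).const_mul b).sub (hint (k + 1))).const_mul c
  have hexp : ∀ x : ℝ, (b - x) * p.eval x ^ 2 = ∑ i : Fin (d + 1), ∑ j : Fin (d + 1),
      (p.coeff i * p.coeff j) * (b * x ^ (i + j : ℕ) - x ^ (i + j + 1 : ℕ)) := by
    intro x
    rw [Polynomial.eval_eq_sum_range' (Nat.lt_succ_of_le hdeg), ← Fin.sum_univ_eq_sum_range
      (fun i => p.coeff i * x ^ i), sq, Finset.sum_mul_sum, Finset.mul_sum]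
    simp only [Finset.mul_sum]
    refine Finset.sum_congr rfl fun i _ => Finset.sum_congr rfl fun j _ => ?_
    ring
  simp only [hexp]
  rw [integral_finsetSum _ fun i _ => integrable_finsetSum _ fun j _ => hterm _ _]
  simp only [dotProduct, Matrix.mulVec, Finset.mul_sum]
  refine Finset.sum_congr rfl fun i _ => ?_
  rw [integral_finsetSum _ fun j _ => hterm _ _]
  refine Finset.sum_congr rfl fun j _ => ?_
  rw [integral_const_mul, integral_sub ((hint _).const_mul b) (hint _), integral_const_mul,
    ← hy, ← hy]
  simp only [negLocMat, Matrix.of_apply]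
  ring

/-- weak duality: if `H_d(-θ_b y) ⪰ 0` and `σ = Σ_ℓ p_ℓ²` is a sum of squares of
polynomials of degree at most `d` with `∫ σ dμ = 1`, then `b ≥ ∫ x σ(x) dμ(x)`. -/
theorem weak_duality_b
    (μ : Measure ℝ) [IsFiniteMeasure μ]
    (hint : ∀ k : ℕ, Integrable (fun x => x ^ k) μ)
    (y : ℕ → ℝ) (hy : ∀ k, y k = ∫ x, x ^ k ∂μ)
    (d : ℕ) (b : ℝ) (hb : (negLocMat y d b).PosSemidef)
    (m : ℕ) (p : Fin m → Polynomial ℝ) (hdeg : ∀ ℓ, (p ℓ).natDegree ≤ d)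
    (hnorm : (∫ x, (∑ ℓ, (p ℓ).eval x ^ 2) ∂μ) = 1) :
    (∫ x, x * (∑ ℓ, (p ℓ).eval x ^ 2) ∂μ) ≤ b := by
  have hσ : Integrable (fun x => ∑ ℓ, (p ℓ).eval x ^ 2) μ := by
    have h := integrable_polynomial_eval hint (∑ ℓ, p ℓ ^ 2)
    simpa [Polynomial.eval_finsetSum] using h
  have hxσ : Integrable (fun x => x * ∑ ℓ, (p ℓ).eval x ^ 2) μ := by
    have h := integrable_polynomial_eval hint (Polynomial.X * ∑ ℓ, p ℓ ^ 2)
    simpa [Polynomial.eval_finsetSum] using h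
  have hsq : ∀ ℓ, Integrable (fun x => (b - x) * (p ℓ).eval x ^ 2) μ := fun ℓ => by
    have h := integrable_polynomial_eval hint ((Polynomial.C b - Polynomial.X) * p ℓ ^ 2)
    simpa using h
  have hnonneg : 0 ≤ ∫ x, (b - x) * ∑ ℓ, (p ℓ).eval x ^ 2 ∂μ := by
    simp only [Finset.mul_sum]
    rw [integral_finsetSum _ fun ℓ _ => hsq ℓ]
    refine Finset.sum_nonneg fun ℓ _ => ?_
    rw [← dotProduct_negLocMat_mulVec hint hy d b (p ℓ) (hdeg ℓ)]
    exact hb.dotProduct_mulVec_nonneg fun i => (p ℓ).coeff i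
  simp only [sub_mul] at hnonneg
  rw [integral_sub (hσ.const_mul b) hxσ, integral_const_mul, hnorm] at hnonneg
  linarith
end

section
/- Let μ be a finite Borel measure on ℝ all of whose moments y_k = ∫ x^k dμ are finite, let c ∈ ℝ, and suppose supp μ ⊆ [c,∞). Let d ∈ ℕ and suppose the moment matrix H_d(y) (entries y_{i+j}, 0 ≤ i,j ≤ d) is positive definite. Then for every a < c the localizing matrix H_d(θ_a y) (entries y_{i+j+1} − a·y_{i+j}) is positive definite. -/
open MeasureTheory Filter

/-- The Hankel moment matrix `H_d(y)` with entries `y_{i+j}`. -/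
noncomputable def momMat (y : ℕ → ℝ) (d : ℕ) :
    Matrix (Fin (d + 1)) (Fin (d + 1)) ℝ :=
  Matrix.of fun i j : Fin (d + 1) => y (i + j : ℕ)

theorem measure_compl_msupport {α : Type*} [TopologicalSpace α] [MeasurableSpace α]
    [SecondCountableTopology α] (μ : Measure α) : μ (msupport μ)ᶜ = 0 := by
  refine measure_null_of_locally_null _ fun x hx => ?_
  simp only [msupport, Set.mem_compl_iff, Set.mem_sInter, not_forall] at hx
  obtain ⟨C, ⟨hC, hC0⟩, hxC⟩ := hx
  exact ⟨Cᶜ, mem_nhdsWithin_of_mem_nhds (hC.isOpen_compl.mem_nhds hxC), hC0⟩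

theorem ae_le_of_msupport_subset_Ici {μ : Measure ℝ} {c : ℝ} (h : msupport μ ⊆ Set.Ici c) :
    ∀ᵐ x ∂μ, c ≤ x :=
  measure_mono_null (Set.compl_subset_compl.mpr h) (measure_compl_msupport μ)

theorem isHermitian_locMat (y : ℕ → ℝ) (d : ℕ) (a : ℝ) : (locMat y d a).IsHermitian := by
  ext i j
  simp [locMat, add_comm]

/-- The quadratic form of the localizing matrix is the integral of `(x - a) p(x)²`. -/
theorem dotProduct_locMat_mulVec {μ : Measure ℝ}
    (hint : ∀ k : ℕ, Integrable (fun x => x ^ k) μ)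
    {y : ℕ → ℝ} (hy : ∀ k, y k = ∫ x, x ^ k ∂μ) (d : ℕ) (a : ℝ) (v : Fin (d + 1) → ℝ) :
    v ⬝ᵥ (locMat y d a).mulVec v = ∫ x, (x - a) * (∑ i, v i * x ^ (i : ℕ)) ^ 2 ∂μ := by
  have hterm (i j : Fin (d + 1)) : Integrable
      (fun x : ℝ => v i * ((x ^ (i + j + 1 : ℕ) - a * x ^ (i + j : ℕ)) * v j)) μ :=
    (((hint _).sub ((hint _).const_mul a)).mul_const _).const_mul _
  have hexpand (x : ℝ) : (x - a) * (∑ i, v i * x ^ (i : ℕ)) ^ 2 =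
      ∑ i : Fin (d + 1), ∑ j : Fin (d + 1),
        v i * ((x ^ (i + j + 1 : ℕ) - a * x ^ (i + j : ℕ)) * v j) := by
    rw [sq, Finset.sum_mul_sum, Finset.mul_sum]
    refine Finset.sum_congr rfl fun i _ => ?_
    rw [Finset.mul_sum]
    refine Finset.sum_congr rfl fun j _ => ?_
    ring
  simp_rw [hexpand]
  rw [integral_finsetSum _ fun i _ => integrable_finsetSum _ fun j _ => hterm i j]
  simp only [dotProduct, Matrix.mulVec, Finset.mul_sum]
  refine Finset.sum_congr rfl fun i _ => ?_
  rw [integral_finsetSum _ fun j _ => hterm i j]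
  refine Finset.sum_congr rfl fun j _ => ?_
  rw [integral_const_mul, integral_mul_const,
    integral_sub (hint _) ((hint _).const_mul a), integral_const_mul]
  simp [locMat, hy]

theorem posSemidef_locMat {μ : Measure ℝ}
    (hint : ∀ k : ℕ, Integrable (fun x => x ^ k) μ)
    {y : ℕ → ℝ} (hy : ∀ k, y k = ∫ x, x ^ k ∂μ) {c : ℝ} (hc : ∀ᵐ x ∂μ, c ≤ x) (d : ℕ) :
    (locMat y d c).PosSemidef := by
  refine .of_dotProduct_mulVec_nonneg (isHermitian_locMat y d c) fun v => ?_
  rw [star_trivial, dotProduct_locMat_mulVec hint hy]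
  refine integral_nonneg_of_ae ?_
  filter_upwards [hc] with x hx
  exact mul_nonneg (sub_nonneg.mpr hx) (sq_nonneg _)

theorem locMat_eq_locMat_add_smul_momMat (y : ℕ → ℝ) (d : ℕ) (a c : ℝ) :
    locMat y d a = locMat y d c + (c - a) • momMat y d := by
  ext i j
  simp only [locMat, momMat, Matrix.of_apply, Matrix.add_apply, Matrix.smul_apply, smul_eq_mul]
  ring

/-- Slater's condition: if `supp μ ⊆ [c, ∞)` and the moment matrix `H_d(y)` is
positive definite, then for every `a < c` the localizing matrix `H_d(θ_a y)` is positive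
definite. -/
theorem locMat_posDef_of_lt
    (μ : Measure ℝ) [IsFiniteMeasure μ]
    (hint : ∀ k : ℕ, Integrable (fun x => x ^ k) μ)
    (y : ℕ → ℝ) (hy : ∀ k, y k = ∫ x, x ^ k ∂μ)
    (c : ℝ) (hsupp : msupport μ ⊆ Set.Ici c)
    (d : ℕ) (hPD : (momMat y d).PosDef) :
    ∀ a : ℝ, a < c → (locMat y d a).PosDef := by
  intro a ha
  rw [locMat_eq_locMat_add_smul_momMat y d a c]
  exact Matrix.PosDef.posSemidef_add
    (posSemidef_locMat hint hy (ae_le_of_msupport_subset_Ici hsupp) d)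
    (hPD.smul (sub_pos.mpr ha))
end
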